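/- Asymptotic probability of non-zero secrecy capacity over α-μ wiretap fading channels (eq. (28)): For α, μ, λ > 0 let g_{α,μ,λ}(x) = (α λ^{αμ}/Γ(μ)) x^{αμ−1} exp(−(λx)^{α}) for x > 0 be the α-μ SNR density with scale λ. Fix α_B, μ_B, α_E, μ_E, λ_E > 0. Let Y be a random variable with density g_{α_E,μ_E,λ_E}, and for each λ_B > 0 let X_{λ_B} be a random variable with density g_{α_B,μ_B,λ_B}, independent of Y. Then lim_{λ_B → ∞} Pr(X_{λ_B} > Y) · λ_B^{α_E μ_E} = Γ(μ_B + α_E μ_E/α_B) λ_E^{α_E μ_E} / (Γ(μ_B) Γ(μ_E) μ_E). -/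

import Mathlib

open MeasureTheory Complex Set Filter
open scoped Real

noncomputable section

/-- Data of a Fox H-kernel: integers `0 ≤ m ≤ q`, `0 ≤ n ≤ p`, real parameters
`a, b` and positive reals `A, B`. -/
structure FoxData where
  p : ℕ
  q : ℕ
  m : ℕ
  n : ℕ
  hm : m ≤ q
  hn : n ≤ p
  a : Fin p → ℝ
  A : Fin p → ℝ
  b : Fin q → ℝ
  B : Fin q → ℝ
  hA : ∀ i, 0 < A i
  hB : ∀ l, 0 < B l

/-- The Fox H-kernel
`Θ(s) = [∏_{l<m} Γ(b_l + B_l s) ∏_{i<n} Γ(1 − a_i − A_i s)] /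
        [∏_{m≤l} Γ(1 − b_l − B_l s) ∏_{n≤i} Γ(a_i + A_i s)]`. -/
noncomputable def FoxData.kernel (D : FoxData) (s : ℂ) : ℂ :=
  ((∏ l : Fin D.q, if l.val < D.m then Complex.Gamma ((D.b l : ℂ) + (D.B l : ℂ) * s) else 1) *
    (∏ i : Fin D.p, if i.val < D.n then Complex.Gamma (1 - (D.a i : ℂ) - (D.A i : ℂ) * s) else 1)) /
  ((∏ l : Fin D.q, if D.m ≤ l.val then Complex.Gamma (1 - (D.b l : ℂ) - (D.B l : ℂ) * s) else 1) *
    (∏ i : Fin D.p, if D.n ≤ i.val then Complex.Gamma ((D.a i : ℂ) + (D.A i : ℂ) * s) else 1))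

/-- The vertical line `Re s = c` contains no pole of the kernel, i.e. none of the
numerator Gamma factors is evaluated at a nonpositive integer on that line. -/
def FoxData.noPoleOn (D : FoxData) (c : ℝ) : Prop :=
  ∀ t : ℝ,
    (∀ l : Fin D.q, l.val < D.m → ∀ k : ℕ,
      (D.b l : ℂ) + (D.B l : ℂ) * ((c : ℂ) + (t : ℂ) * Complex.I) ≠ -(k : ℂ)) ∧
    (∀ i : Fin D.p, i.val < D.n → ∀ k : ℕ,
      1 - (D.a i : ℂ) - (D.A i : ℂ) * ((c : ℂ) + (t : ℂ) * Complex.I) ≠ -(k : ℂ))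

/-- `f` is a Fox H-function density with data `(κ, λ, Θ, c)`:
`κ, λ > 0`, `t ↦ Θ(c+it)` is absolutely integrable, the line `Re s = c` contains no
pole of `Θ`, `f(x) = (κ/(2π)) ∫_ℝ Θ(c+it) (λx)^{−(c+it)} dt` for `x > 0`, and `f` is a
probability density on `(0,∞)`. -/
def IsFoxDensity (f : ℝ → ℝ) (κ lam : ℝ) (D : FoxData) (c : ℝ) : Prop :=
  0 < κ ∧ 0 < lam ∧ Measurable f ∧
  Integrable (fun t : ℝ => D.kernel ((c : ℂ) + (t : ℂ) * Complex.I)) ∧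
  D.noPoleOn c ∧
  (∀ x : ℝ, 0 < x →
    (f x : ℂ) = (κ : ℂ) / (2 * (π : ℝ)) *
      ∫ t : ℝ, D.kernel ((c : ℂ) + (t : ℂ) * Complex.I) *
        ((lam * x : ℝ) : ℂ) ^ (-((c : ℂ) + (t : ℂ) * Complex.I))) ∧
  (∀ x, 0 ≤ f x) ∧ (∫ x in Ioi (0 : ℝ), f x = 1)

/-- The CCDF representation holds for `f` (with data `(κ, λ, Θ, ·)`) at level `σ' > 0`:
`∫_x^∞ f(u) du = (κ/(2πλ)) ∫_ℝ [Θ(1+ξ)/ξ] (λx)^{−ξ} dt` for all `x > 0`, `ξ = σ' + it`. -/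
def HasCCDFRep (f : ℝ → ℝ) (κ lam : ℝ) (D : FoxData) (σ' : ℝ) : Prop :=
  0 < σ' ∧ ∀ x : ℝ, 0 < x →
    ((∫ u in Ioi x, f u : ℝ) : ℂ) = (κ : ℂ) / (2 * (π : ℝ) * lam) *
      ∫ t : ℝ, (D.kernel (1 + ((σ' : ℂ) + (t : ℂ) * Complex.I)) /
          ((σ' : ℂ) + (t : ℂ) * Complex.I)) *
        ((lam * x : ℝ) : ℂ) ^ (-((σ' : ℂ) + (t : ℂ) * Complex.I))

/-- The random variable `X` has probability density `f` (w.r.t. Lebesgue measure). -/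
def HasDensity {Ω : Type*} [MeasurableSpace Ω] (μ : Measure Ω) (X : Ω → ℝ) (f : ℝ → ℝ) : Prop :=
  Measurable X ∧ Measure.map X μ = volume.withDensity (fun x => ENNReal.ofReal (f x))

/-- The α-μ SNR density with parameters `α, μ` and scale `λ`:
`g(x) = (α λ^{αμ}/Γ(μ)) x^{αμ−1} exp(−(λx)^α)` for `x > 0`, and `0` otherwise. -/
noncomputable def alphaMuPdf (α μ lam : ℝ) (x : ℝ) : ℝ :=
  if 0 < x then α * lam ^ (α * μ) / Real.Gamma μ * x ^ (α * μ - 1) *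
    Real.exp (-(lam * x) ^ α) else 0

lemma alphaMuPdf_nonneg {α μ lam : ℝ} (hα : 0 < α) (hμ : 0 < μ) (hlam : 0 < lam) (x : ℝ) :
    0 ≤ alphaMuPdf α μ lam x := by
  have := Real.Gamma_pos_of_pos hμ
  unfold alphaMuPdf
  split_ifs <;> positivity

lemma measurable_alphaMuPdf (α μ lam : ℝ) : Measurable (alphaMuPdf α μ lam) := by
  unfold alphaMuPdf
  exact Measurable.ite measurableSet_Ioi (by fun_prop) measurable_const

lemma alphaMuPdf_eq_mul_comp {α μ lam : ℝ} (hlam : 0 < lam) {x : ℝ} (hx : 0 < x) :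
    alphaMuPdf α μ lam x = lam * alphaMuPdf α μ 1 (lam * x) := by
  have h1 : lam ^ (α * μ) = lam ^ (α * μ - 1) * lam := by
    rw [Real.rpow_sub_one hlam.ne', div_mul_cancel₀ _ hlam.ne']
  simp only [alphaMuPdf, if_pos hx, if_pos (mul_pos hlam hx), Real.one_rpow, one_mul]
  rw [Real.mul_rpow (z := α * μ - 1) hlam.le hx.le, h1]
  ring

/-- The integral of `t ^ (c - 1)` over `(0, y)`, as a lower Lebesgue integral. -/
lemma lintegral_Ioo_mul_rpow {K c y : ℝ} (hK : 0 ≤ K) (hc : 0 < c) (hy : 0 < y) :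
    ∫⁻ t in Ioo 0 y, ENNReal.ofReal (K * t ^ (c - 1)) = ENNReal.ofReal (K * (y ^ c / c)) := by
  have hint : IntervalIntegrable (fun t : ℝ => K * t ^ (c - 1)) volume 0 y :=
    (intervalIntegral.intervalIntegrable_rpow' (by linarith)).const_mul K
  rw [← ofReal_integral_eq_lintegral_ofReal]
  · rw [← integral_Ioc_eq_integral_Ioo, ← intervalIntegral.integral_of_le hy.le,
      intervalIntegral.integral_const_mul, integral_rpow (Or.inl (by linarith))]
    simp [Real.zero_rpow hc.ne']
  · exact ((intervalIntegrable_iff_integrableOn_Ioc_of_le hy.le).1 hint).mono_set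
      Ioo_subset_Ioc_self
  · filter_upwards [ae_restrict_mem measurableSet_Ioo] with t ht
    have := ht.1
    positivity

/-- Two-sided bound on the distribution function of an α-μ random variable near the origin. -/
lemma alphaMu_cdf_bounds {α μ lam : ℝ} (hα : 0 < α) (hμ : 0 < μ) (hlam : 0 < lam)
    {y : ℝ} (hy : 0 < y) {ν : Measure ℝ} [IsProbabilityMeasure ν]
    (hν : ν = volume.withDensity (fun x => ENNReal.ofReal (alphaMuPdf α μ lam x))) :
    Real.exp (-(lam * y) ^ α) * (lam ^ (α * μ) / (Real.Gamma μ * μ)) * y ^ (α * μ) ≤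
        ν.real (Iio y) ∧
      ν.real (Iio y) ≤ lam ^ (α * μ) / (Real.Gamma μ * μ) * y ^ (α * μ) := by
  have hG := Real.Gamma_pos_of_pos hμ
  have hset : ν (Iio y) = ∫⁻ t in Ioo 0 y, ENNReal.ofReal (alphaMuPdf α μ lam t) := by
    rw [hν, withDensity_apply _ measurableSet_Iio, ← lintegral_indicator measurableSet_Iio,
      ← lintegral_indicator measurableSet_Ioo]
    congr 1 with x
    by_cases hx : 0 < x <;> simp [indicator, alphaMuPdf, hx]
  have hupper : ν (Iio y) ≤
      ENNReal.ofReal (α * lam ^ (α * μ) / Real.Gamma μ * (y ^ (α * μ) / (α * μ))) := by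
    rw [hset, ← lintegral_Ioo_mul_rpow (by positivity) (by positivity) hy]
    refine setLIntegral_mono' measurableSet_Ioo fun t ht => ENNReal.ofReal_le_ofReal ?_
    have ht0 := ht.1
    rw [alphaMuPdf, if_pos ht0]
    refine mul_le_of_le_one_right (by positivity) ?_
    rw [Real.exp_le_one_iff, neg_nonpos]
    positivity
  have hlower : ENNReal.ofReal (Real.exp (-(lam * y) ^ α) * (α * lam ^ (α * μ) / Real.Gamma μ) *
      (y ^ (α * μ) / (α * μ))) ≤ ν (Iio y) := by
    rw [hset, ← lintegral_Ioo_mul_rpow (by positivity) (by positivity) hy]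
    refine setLIntegral_mono' measurableSet_Ioo fun t ht => ENNReal.ofReal_le_ofReal ?_
    have ht0 := ht.1
    rw [alphaMuPdf, if_pos ht0, mul_assoc, mul_comm]
    have : Real.exp (-(lam * y) ^ α) ≤ Real.exp (-(lam * t) ^ α) := by
      have := ht.2.le
      gcongr
    gcongr
  constructor
  · refine Eq.trans_le ?_ ((ENNReal.ofReal_le_iff_le_toReal (measure_ne_top ν _)).1 hlower)
    field_simp
  · refine (ENNReal.toReal_le_of_le_ofReal (by positivity) hupper).trans_eq ?_
    field_simp

lemma tendsto_alphaMu_cdf {α μ lam : ℝ} (hα : 0 < α) (hμ : 0 < μ) (hlam : 0 < lam)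
    {ν : Measure ℝ} [IsProbabilityMeasure ν]
    (hν : ν = volume.withDensity (fun x => ENNReal.ofReal (alphaMuPdf α μ lam x)))
    {z : ℝ} (hz : 0 < z) :
    Tendsto (fun l : ℝ => ν.real (Iio (z / l)) * l ^ (α * μ)) atTop
      (nhds (lam ^ (α * μ) / (Real.Gamma μ * μ) * z ^ (α * μ))) := by
  have hmul : ∀ l : ℝ, 0 < l → (z / l) ^ (α * μ) * l ^ (α * μ) = z ^ (α * μ) := by
    intro l hl
    rw [← Real.mul_rpow (by positivity) hl.le, div_mul_cancel₀ _ hl.ne']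
  have hexp : Tendsto (fun l : ℝ => Real.exp (-(lam * (z / l)) ^ α)) atTop (nhds 1) := by
    have h0 : Tendsto (fun l : ℝ => lam * (z / l)) atTop (nhds 0) := by
      simpa using (tendsto_const_nhds.div_atTop tendsto_id).const_mul lam
    have h1 := (h0.rpow_const (p := α) (Or.inr hα.le)).neg
    rw [Real.zero_rpow hα.ne', neg_zero] at h1
    simpa [Function.comp_def] using (Real.continuous_exp.tendsto 0).comp h1
  have hlow : Tendsto (fun l : ℝ => Real.exp (-(lam * (z / l)) ^ α) *
      (lam ^ (α * μ) / (Real.Gamma μ * μ) * z ^ (α * μ))) atTop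
      (nhds (lam ^ (α * μ) / (Real.Gamma μ * μ) * z ^ (α * μ))) := by
    simpa using hexp.mul_const (lam ^ (α * μ) / (Real.Gamma μ * μ) * z ^ (α * μ))
  refine tendsto_of_tendsto_of_tendsto_of_le_of_le' hlow tendsto_const_nhds ?_ ?_
  · filter_upwards [eventually_gt_atTop 0] with l hl
    have h := (alphaMu_cdf_bounds hα hμ hlam (div_pos hz hl) hν).1
    rw [← hmul l hl, ← mul_assoc, ← mul_assoc]
    gcongr
  · filter_upwards [eventually_gt_atTop 0] with l hl
    have h := (alphaMu_cdf_bounds hα hμ hlam (div_pos hz hl) hν).2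
    rw [← hmul l hl, ← mul_assoc]
    gcongr

lemma rpow_mul_alphaMuPdf_one {α μ c z : ℝ} (hz : 0 < z) :
    z ^ c * alphaMuPdf α μ 1 z =
      α / Real.Gamma μ * (z ^ (α * μ + c - 1) * Real.exp (-z ^ α)) := by
  rw [alphaMuPdf, if_pos hz, Real.one_rpow, one_mul, mul_one,
    show α * μ + c - 1 = c + (α * μ - 1) by ring, Real.rpow_add hz]
  ring

lemma integrableOn_rpow_mul_alphaMuPdf_one {α μ c : ℝ} (hα : 0 < α) (hμ : 0 < μ) (hc : 0 < c) :
    IntegrableOn (fun z => z ^ c * alphaMuPdf α μ 1 z) (Ioi 0) := by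
  have hs : 0 < α * μ := by positivity
  have h := (integrableOn_rpow_mul_exp_neg_rpow (s := α * μ + c - 1) (by linarith) hα).const_mul
    (α / Real.Gamma μ)
  exact IntegrableOn.congr_fun h (fun z hz => (rpow_mul_alphaMuPdf_one hz).symm) measurableSet_Ioi

/-- The moments of the α-μ distribution with unit scale. -/
lemma integral_rpow_mul_alphaMuPdf_one {α μ c : ℝ} (hα : 0 < α) (hμ : 0 < μ) (hc : 0 < c) :
    ∫ z in Ioi 0, z ^ c * alphaMuPdf α μ 1 z = Real.Gamma (μ + c / α) / Real.Gamma μ := by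
  have hs : 0 < α * μ := by positivity
  rw [setIntegral_congr_fun measurableSet_Ioi fun z hz => rpow_mul_alphaMuPdf_one hz,
    integral_const_mul, integral_rpow_mul_exp_neg_rpow hα (by linarith),
    show (α * μ + c - 1 + 1) / α = μ + c / α by field_simp; ring]
  field_simp

/-- The probability that an α-μ variable exceeds an independent one, as an integral of the
rescaled distribution function of the latter. -/
lemma measure_lt_eq_integral {Ω : Type*} [MeasurableSpace Ω] {P : Measure Ω}
    [IsProbabilityMeasure P] {α μ l : ℝ} (hα : 0 < α) (hμ : 0 < μ) (hl : 0 < l)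
    {X Y : Ω → ℝ} (hY : Measurable Y) (hX : HasDensity P X (alphaMuPdf α μ l))
    (hXY : ProbabilityTheory.IndepFun X Y P) :
    (P {ω | Y ω < X ω}).toReal =
      ∫ z in Ioi 0, (P.map Y).real (Iio (z / l)) * alphaMuPdf α μ 1 z := by
  have : IsProbabilityMeasure (P.map Y) := Measure.isProbabilityMeasure_map hY.aemeasurable
  have hmono : Monotone fun x => (P.map Y) (Iio x) :=
    fun a b hab => measure_mono (Iio_subset_Iio hab)
  have hS : MeasurableSet {p : ℝ × ℝ | p.2 < p.1} := measurableSet_lt measurable_snd measurable_fst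
  have hmeas : P {ω | Y ω < X ω} =
      ∫⁻ x, ENNReal.ofReal (alphaMuPdf α μ l x) * (P.map Y) (Iio x) := by
    have h1 : P {ω | Y ω < X ω} = P.map (fun ω => (X ω, Y ω)) {p : ℝ × ℝ | p.2 < p.1} := by
      rw [Measure.map_apply (hX.1.prodMk hY) hS]
      rfl
    rw [h1, (ProbabilityTheory.indepFun_iff_map_prod_eq_prod_map_map hX.1.aemeasurable
      hY.aemeasurable).1 hXY, Measure.prod_apply hS, hX.2,
      lintegral_withDensity_eq_lintegral_mul _ (measurable_alphaMuPdf α μ l).ennreal_ofReal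
        (measurable_measure_prodMk_left hS)]
    rfl
  have hreal : (P {ω | Y ω < X ω}).toReal =
      ∫ x, alphaMuPdf α μ l x * (P.map Y).real (Iio x) := by
    rw [hmeas, ← integral_toReal]
    · simp only [ENNReal.toReal_mul, ENNReal.toReal_ofReal (alphaMuPdf_nonneg hα hμ hl _)]
      rfl
    · exact ((measurable_alphaMuPdf α μ l).ennreal_ofReal.mul hmono.measurable).aemeasurable
    · exact ae_of_all _ fun x => ENNReal.mul_lt_top ENNReal.ofReal_lt_top (measure_lt_top _ _)
  have hIoi : ∫ x, alphaMuPdf α μ l x * (P.map Y).real (Iio x) =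
      ∫ x in Ioi 0, alphaMuPdf α μ l x * (P.map Y).real (Iio x) := by
    symm
    apply setIntegral_eq_integral_of_forall_compl_eq_zero
    intro x hx
    have hx' : ¬ 0 < x := hx
    rw [alphaMuPdf, if_neg hx', zero_mul]
  have hscale := integral_comp_mul_left_Ioi
    (fun z => (P.map Y).real (Iio (z / l)) * alphaMuPdf α μ 1 z) 0 hl
  rw [mul_zero, smul_eq_mul, eq_inv_mul_iff_mul_eq₀ hl.ne', ← integral_const_mul] at hscale
  rw [hreal, hIoi, ← hscale]
  refine setIntegral_congr_fun measurableSet_Ioi fun x hx => ?_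
  simp only [alphaMuPdf_eq_mul_comp hl (mem_Ioi.1 hx), mul_div_cancel_left₀ x hl.ne']
  ring

/-- **Asymptotic probability of non-zero secrecy capacity over α-μ wiretap fading
channels (eq. (28)).**
With `Y` α-μ distributed with parameters `(α_E, μ_E, λ_E)` and, for each `λ_B > 0`,
`X_{λ_B}` α-μ distributed with parameters `(α_B, μ_B, λ_B)` and independent of `Y`,
`lim_{λ_B → ∞} Pr(X_{λ_B} > Y) λ_B^{α_E μ_E}
  = Γ(μ_B + α_E μ_E/α_B) λ_E^{α_E μ_E} / (Γ(μ_B) Γ(μ_E) μ_E)`. -/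
theorem pnz_asymptotic_alphaMu {Ω : Type*} [MeasurableSpace Ω] (μ : Measure Ω)
    [IsProbabilityMeasure μ]
    (αB μB αE μE lamE : ℝ)
    (hαB : 0 < αB) (hμB : 0 < μB) (hαE : 0 < αE) (hμE : 0 < μE) (hlamE : 0 < lamE)
    (Y : Ω → ℝ) (hY : HasDensity μ Y (alphaMuPdf αE μE lamE))
    (X : ℝ → Ω → ℝ)
    (hX : ∀ l : ℝ, 0 < l → HasDensity μ (X l) (alphaMuPdf αB μB l) ∧
      ProbabilityTheory.IndepFun (X l) Y μ) :
    Tendsto (fun l : ℝ => (μ {ω | Y ω < X l ω}).toReal * l ^ (αE * μE)) atTop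
      (nhds (Real.Gamma (μB + αE * μE / αB) * lamE ^ (αE * μE) /
        (Real.Gamma μB * Real.Gamma μE * μE))) := by
  have : IsProbabilityMeasure (μ.map Y) := Measure.isProbabilityMeasure_map hY.1.aemeasurable
  have hc : 0 < αE * μE := by positivity
  have hG := Real.Gamma_pos_of_pos hμE
  have hmono : Monotone fun x => (μ.map Y).real (Iio x) :=
    fun a b hab => measureReal_mono (Iio_subset_Iio hab)
  set C := lamE ^ (αE * μE) / (Real.Gamma μE * μE) with hC
  have hC0 : 0 ≤ C := by positivity
  have key : Tendsto (fun l : ℝ => ∫ z in Ioi 0,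
      (μ.map Y).real (Iio (z / l)) * l ^ (αE * μE) * alphaMuPdf αB μB 1 z) atTop
      (nhds (∫ z in Ioi 0, C * z ^ (αE * μE) * alphaMuPdf αB μB 1 z)) := by
    refine tendsto_integral_filter_of_dominated_convergence
      (fun z => C * (z ^ (αE * μE) * alphaMuPdf αB μB 1 z)) ?_ ?_ ?_ ?_
    · refine Eventually.of_forall fun l => Measurable.aestronglyMeasurable ?_
      exact ((hmono.measurable.comp (measurable_id.div_const l)).mul_const _).mul
        (measurable_alphaMuPdf αB μB 1)
    · filter_upwards [eventually_gt_atTop 0] with l hl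
      filter_upwards [ae_restrict_mem measurableSet_Ioi] with z hz
      have hz0 : 0 < z := hz
      have hpdf := alphaMuPdf_nonneg hαB hμB one_pos z
      have h := (alphaMu_cdf_bounds hαE hμE hlamE (div_pos hz0 hl) hY.2).2
      rw [Real.norm_of_nonneg (by positivity), ← mul_assoc]
      refine mul_le_mul_of_nonneg_right ?_ hpdf
      calc _ ≤ C * (z / l) ^ (αE * μE) * l ^ (αE * μE) := by gcongr
        _ = _ := by
          rw [mul_assoc, ← Real.mul_rpow (by positivity) hl.le, div_mul_cancel₀ _ hl.ne']
    · exact (integrableOn_rpow_mul_alphaMuPdf_one hαB hμB hc).const_mul C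
    · filter_upwards [ae_restrict_mem measurableSet_Ioi] with z hz
      exact (tendsto_alphaMu_cdf hαE hμE hlamE hY.2 hz).mul_const _
  have hlim : ∫ z in Ioi 0, C * z ^ (αE * μE) * alphaMuPdf αB μB 1 z =
      Real.Gamma (μB + αE * μE / αB) * lamE ^ (αE * μE) /
        (Real.Gamma μB * Real.Gamma μE * μE) := by
    simp only [mul_assoc C]
    rw [integral_const_mul, integral_rpow_mul_alphaMuPdf_one hαB hμB hc, hC,
      div_mul_div_comm]
    congr 1 <;> ring
  rw [← hlim]
  refine key.congr' ?_
  filter_upwards [eventually_gt_atTop 0] with l hl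
  rw [measure_lt_eq_integral hαB hμB hl hY.1 (hX l hl).1 (hX l hl).2, ← integral_mul_const]
  congr 1 with z
  ring
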